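/- Let p,q ≥ 1, let π ∈ S_ann-nc(p,q) and ρ ∈ S_disc-nc(p,q) with π ⪯ ρ̂ in S_nc-sd(p,q), and let K be the intersection of the set of elements in bridges of τ_{p,q}π⁻¹ with the union of the two cycles of ρ containing the bridges of π. Then every cycle of Kr_ρ⁻¹(π) = ρπ⁻¹ is either entirely contained in K or disjoint from K; moreover, every cycle of ρπ⁻¹ disjoint from K is also a cycle of Kr_ρ⁻¹(π₀) = ρπ₀⁻¹. -/

import Mathlib

namespace AnnNC

/-- The orbit ("same cycle") setoid of a permutation. -/
def orbitSetoid {α : Type*} (σ : Equiv.Perm α) : Setoid α :=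
  ⟨σ.SameCycle, ⟨fun x => Equiv.Perm.SameCycle.refl σ x,
    fun h => h.symm, fun h h' => h.trans h'⟩⟩

/-- Number of orbits (cycles, counting fixed points) of a permutation. -/
noncomputable def numOrbits {α : Type*} (σ : Equiv.Perm α) : ℕ :=
  Nat.card (Quotient (orbitSetoid σ))

/-- Number of blocks of the join `Π(σ) ∨ Π(ρ)` of the orbit partitions. -/
noncomputable def numJoin {α : Type*} (σ ρ : Equiv.Perm α) : ℕ :=
  Nat.card (Quotient (orbitSetoid σ ⊔ orbitSetoid ρ))

/-- Euler characteristic `χ_ρ(π) = #(ρ) + #(π) + #(π⁻¹ρ) − n`. -/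
noncomputable def euler {α : Type*} (ρ π : Equiv.Perm α) : ℤ :=
  (numOrbits ρ : ℤ) + (numOrbits π : ℤ) + (numOrbits (π⁻¹ * ρ) : ℤ) - (Nat.card α : ℤ)

/-- `π` is noncrossing on `ρ`. -/
def IsNoncrossingOn {α : Type*} (π ρ : Equiv.Perm α) : Prop :=
  euler ρ π = 2 * (numJoin π ρ : ℤ)

/-- Euler characteristic of permutations regarded as permutations of a subset `S`
(for permutations fixing the complement of `S` pointwise). -/
noncomputable def eulerOn {α : Type*} (S : Set α) (ρ π : Equiv.Perm α) : ℤ :=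
  ((numOrbits ρ : ℤ) - (Nat.card (Sᶜ : Set α) : ℤ)) +
    ((numOrbits π : ℤ) - (Nat.card (Sᶜ : Set α) : ℤ)) +
    ((numOrbits (π⁻¹ * ρ) : ℤ) - (Nat.card (Sᶜ : Set α) : ℤ)) - (Nat.card (S : Set α) : ℤ)

/-- `π` is noncrossing on `ρ`, both regarded as permutations of the subset `S`. -/
def IsNoncrossingWithin {α : Type*} (S : Set α) (π ρ : Equiv.Perm α) : Prop :=
  eulerOn S ρ π = 2 * ((numJoin π ρ : ℤ) - (Nat.card (Sᶜ : Set α) : ℤ))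

/-- `τ_{p,q} = (1,…,p)(p+1,…,p+q)` as a permutation of `Fin (p+q)`. -/
def tauPQ (p q : ℕ) : Equiv.Perm (Fin (p + q)) :=
  Equiv.permCongr finSumFinEquiv (Equiv.sumCongr (finRotate p) (finRotate q))

/-- Disc-noncrossing permutations: noncrossing on `τ_{p,q}` and the orbit partition
refines that of `τ_{p,q}`. -/
def SDiscNC (p q : ℕ) : Set (Equiv.Perm (Fin (p + q))) :=
  {π | IsNoncrossingOn π (tauPQ p q) ∧
    ∀ x y : Fin (p + q), π.SameCycle x y → ((x : ℕ) < p ↔ (y : ℕ) < p)}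

/-- Annular-noncrossing permutations: noncrossing on `τ_{p,q}` with at least one bridge. -/
def SAnnNC (p q : ℕ) : Set (Equiv.Perm (Fin (p + q))) :=
  {π | IsNoncrossingOn π (tauPQ p q) ∧
    ∃ a b : Fin (p + q), π.SameCycle a b ∧ (a : ℕ) < p ∧ p ≤ (b : ℕ)}

/-- The set of elements lying in bridges of `σ`. -/
def BridgeSet (p q : ℕ) (σ : Equiv.Perm (Fin (p + q))) : Set (Fin (p + q)) :=
  {x | ∃ a b : Fin (p + q), σ.SameCycle x a ∧ σ.SameCycle x b ∧ (a : ℕ) < p ∧ p ≤ (b : ℕ)}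

/-- `π₀` is the permutation induced by `π` on the partition `Π(τ_{p,q})`
(the first–return map of `π` to each of the two sides). -/
def IsPiZero (p q : ℕ) (π π₀ : Equiv.Perm (Fin (p + q))) : Prop :=
  ∀ a : Fin (p + q), ∃ k : ℕ, 0 < k ∧ π₀ a = (π ^ k) a ∧
    (((a : ℕ) < p) ↔ (((π ^ k) a : ℕ) < p)) ∧
    ∀ j : ℕ, 0 < j → j < k → ¬ (((a : ℕ) < p) ↔ (((π ^ j) a : ℕ) < p))

/-- The order `π ⪯ ρ` for (unhatted) permutations: the orbit partition of `π` refines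
that of `ρ` and `π` is noncrossing on `ρ`. -/
def permLe {α : Type*} (π ρ : Equiv.Perm α) : Prop :=
  (∀ x y : α, π.SameCycle x y → ρ.SameCycle x y) ∧ IsNoncrossingOn π ρ

/-- The order relation `π ⪯ ρ̂` in `S_nc-sd(p,q)`, i.e. `Kr(ρ) ⪯ Kr(π)`. -/
def leAnnHat (p q : ℕ) (π ρ : Equiv.Perm (Fin (p + q))) : Prop :=
  permLe (ρ⁻¹ * tauPQ p q) (π⁻¹ * tauPQ p q)

/-- `σ` is the permutation induced by `π` on the subset `J` (first-return map),
extended by the identity off `J`. -/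
def IsInducedOn {α : Type*} (π σ : Equiv.Perm α) (J : Set α) : Prop :=
  (∀ a ∉ J, σ a = a) ∧
  ∀ a ∈ J, ∃ k : ℕ, 0 < k ∧ σ a = (π ^ k) a ∧ (π ^ k) a ∈ J ∧
    ∀ j : ℕ, 0 < j → j < k → (π ^ j) a ∉ J

/-- The size of an orbit of a permutation. -/
noncomputable def orbitSize {α : Type*} (σ : Equiv.Perm α) (c : Quotient (orbitSetoid σ)) : ℕ :=
  Nat.card {x : α // Quotient.mk (orbitSetoid σ) x = c}

/-- `∏_{U ∈ Π(σ)} (−1)^{|U|−1} C_{|U|−1}`. -/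
noncomputable def catProd {α : Type*} (σ : Equiv.Perm α) : ℤ :=
  ∏ᶠ c : Quotient (orbitSetoid σ),
    ((-1 : ℤ) ^ (orbitSize σ c - 1) * (catalan (orbitSize σ c - 1) : ℤ))

/-- The carrier of the poset `S_nc-sd(p,q)`: pairs (permutation, hatted?). -/
def NCSDSet (p q : ℕ) : Set (Equiv.Perm (Fin (p + q)) × Bool) :=
  {z | (z.2 = false ∧ (z.1 ∈ SDiscNC p q ∪ SAnnNC p q)) ∨ (z.2 = true ∧ z.1 ∈ SDiscNC p q)}

/-- The partial order of `S_nc-sd(p,q)`. -/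
def ncsdLe (p q : ℕ) (a b : Equiv.Perm (Fin (p + q)) × Bool) : Prop :=
  (a.2 = false ∧ b.2 = false ∧ permLe a.1 b.1) ∨
  (b.2 = true ∧ permLe (b.1⁻¹ * tauPQ p q) (a.1⁻¹ * tauPQ p q))

end AnnNC

namespace AnnNC

open Equiv Equiv.Perm

/-- The equivalence relation generated by the single pair `(x, y)`. -/
def pairSetoid {α : Type*} (x y : α) : Setoid α :=
  Relation.EqvGen.setoid fun a b => a = x ∧ b = y

theorem pairSetoid_rel {α : Type*} (x y : α) : pairSetoid x y x y :=
  Relation.EqvGen.rel _ _ ⟨rfl, rfl⟩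

theorem pairSetoid_le_iff {α : Type*} {x y : α} {s : Setoid α} :
    pairSetoid x y ≤ s ↔ s x y := by
  refine ⟨fun h => h (pairSetoid_rel x y), fun h a b hab => ?_⟩
  induction hab with
  | rel a b hab => obtain ⟨rfl, rfl⟩ := hab; exact h
  | refl a => exact s.refl a
  | symm a b _ ih => exact s.symm ih
  | trans a b c _ _ ih₁ ih₂ => exact s.trans ih₁ ih₂

theorem surjective_map_of_le {α : Type*} {s t : Setoid α} (h : s ≤ t) :
    Function.Surjective (Quotient.map' (s₁ := s) (s₂ := t) id h) := by
  intro c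
  induction c using Quotient.inductionOn' with
  | h a => exact ⟨Quotient.mk s a, rfl⟩

theorem card_quotient_le_of_le {α : Type*} [Finite α] {s t : Setoid α} (h : s ≤ t) :
    Nat.card (Quotient t) ≤ Nat.card (Quotient s) :=
  Nat.card_le_card_of_surjective _ (surjective_map_of_le h)

theorem eq_of_le_of_card_quotient_le {α : Type*} [Finite α] {s t : Setoid α} (h : s ≤ t)
    (hc : Nat.card (Quotient s) ≤ Nat.card (Quotient t)) : s = t := by
  refine le_antisymm h fun a b hab => ?_
  have hb := (surjective_map_of_le h).bijective_of_nat_card_le hc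
  exact Quotient.exact (hb.1 (a₁ := Quotient.mk s a) (a₂ := Quotient.mk s b)
    (Quotient.sound (s := t) hab))

theorem card_quotient_le_sup_pairSetoid {α : Type*} [Finite α] (s : Setoid α) (x y : α) :
    Nat.card (Quotient s) ≤ Nat.card (Quotient (s ⊔ pairSetoid x y)) + 1 := by
  classical
  let h : α → Quotient s := fun a => if s a y then Quotient.mk s x else Quotient.mk s a
  have hle : s ⊔ pairSetoid x y ≤ Setoid.ker h := by
    refine sup_le (fun a b hab => ?_) (pairSetoid_le_iff.2 ?_)
    · have : s a y ↔ s b y := ⟨fun h => s.trans (s.symm hab) h, fun h => s.trans hab h⟩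
      simp only [Setoid.ker_def, h, this]
      split_ifs
      · rfl
      · exact Quotient.sound hab
    · simp only [Setoid.ker_def, h, s.refl y, if_true, ite_self]
  have key : ∀ a b, ¬ s a y → ¬ s b y → (s ⊔ pairSetoid x y) a b → s a b := by
    intro a b ha hb hab
    have := hle hab
    simp only [Setoid.ker_def, h, ha, hb, if_false] at this
    exact Quotient.exact this
  let m : Quotient s → Quotient (s ⊔ pairSetoid x y) :=
    Quotient.map' (s₁ := s) (s₂ := s ⊔ pairSetoid x y) id
      (show s ≤ s ⊔ pairSetoid x y from le_sup_left)
  let g : Quotient s → Option (Quotient (s ⊔ pairSetoid x y)) :=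
    fun c => if c = Quotient.mk s y then none else some (m c)
  have hg : Function.Injective g := by
    intro c d hcd
    induction c using Quotient.inductionOn with
    | h a =>
    induction d using Quotient.inductionOn with
    | h b =>
    by_cases ha : Quotient.mk s a = Quotient.mk s y <;>
      by_cases hb : Quotient.mk s b = Quotient.mk s y
    · rw [ha, hb]
    · simp [g, ha, hb] at hcd
    · simp [g, ha, hb] at hcd
    · simp only [g, ha, hb, if_false, Option.some.injEq] at hcd
      exact Quotient.sound (key a b (fun h => ha (Quotient.sound h))
        (fun h => hb (Quotient.sound h)) (Quotient.exact hcd))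
  have := Nat.card_le_card_of_injective g hg
  rwa [Finite.card_option] at this

theorem card_quotient_sup_pairSetoid_lt {α : Type*} [Finite α] {s : Setoid α} {x y : α}
    (h : ¬ s x y) :
    Nat.card (Quotient (s ⊔ pairSetoid x y)) < Nat.card (Quotient s) := by
  by_contra! hc
  rw [eq_of_le_of_card_quotient_le le_sup_left hc] at h
  exact h ((le_sup_right : pairSetoid x y ≤ s ⊔ pairSetoid x y) (pairSetoid_rel x y))

theorem orbitSetoid_le_iff {α : Type*} [Finite α] {f : Perm α} {s : Setoid α} :
    orbitSetoid f ≤ s ↔ ∀ a, s a (f a) := by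
  refine ⟨fun h a => h (sameCycle_apply_right.2 (SameCycle.refl f a)), fun h a b hab => ?_⟩
  obtain ⟨k, rfl⟩ := SameCycle.exists_nat_pow_eq hab
  clear hab
  induction k with
  | zero => exact s.refl a
  | succ k ih =>
    rw [pow_succ', Perm.mul_apply]
    exact s.trans ih (h _)

theorem orbitSetoid_apply {α : Type*} (f : Perm α) (a : α) : orbitSetoid f a (f a) :=
  sameCycle_apply_right.2 (SameCycle.refl f a)

theorem apply_inv_apply {α : Type*} (f : Perm α) (a : α) : f (f⁻¹ a) = a := f.apply_symm_apply a

theorem sameCycle_inv_apply_self {α : Type*} (f : Perm α) (a : α) : f.SameCycle a (f⁻¹ a) :=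
  ⟨-1, by rw [zpow_neg_one]⟩

theorem orbitSetoid_inv {α : Type*} (f : Perm α) : orbitSetoid f⁻¹ = orbitSetoid f :=
  Setoid.ext fun _ _ => sameCycle_inv

theorem numOrbits_inv {α : Type*} (f : Perm α) : numOrbits f⁻¹ = numOrbits f := by
  rw [numOrbits, numOrbits, orbitSetoid_inv]

theorem numOrbits_conj {α : Type*} (g f : Perm α) : numOrbits (g * f * g⁻¹) = numOrbits f := by
  refine (Nat.card_congr (Quotient.congr g fun a b => ?_)).symm
  change f.SameCycle a b ↔ (g * f * g⁻¹).SameCycle (g a) (g b)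
  simp [sameCycle_conj]

theorem orbitSetoid_mul_le {α : Type*} [Finite α] (f g : Perm α) :
    orbitSetoid (f * g) ≤ orbitSetoid f ⊔ orbitSetoid g :=
  orbitSetoid_le_iff.2 fun a => (orbitSetoid f ⊔ orbitSetoid g).trans
    ((le_sup_right : orbitSetoid g ≤ orbitSetoid f ⊔ orbitSetoid g) (orbitSetoid_apply g a))
    ((le_sup_left : orbitSetoid f ≤ orbitSetoid f ⊔ orbitSetoid g) (orbitSetoid_apply f (g a)))

section Swap

variable {α : Type*} [Finite α] [DecidableEq α]

theorem orbitSetoid_swap_le (x y : α) : orbitSetoid (swap x y) ≤ pairSetoid x y := by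
  refine orbitSetoid_le_iff.2 fun a => ?_
  by_cases hx : a = x
  · subst hx
    rw [swap_apply_left]
    exact pairSetoid_rel a y
  by_cases hy : a = y
  · subst hy
    rw [swap_apply_right]
    exact (pairSetoid x a).symm (pairSetoid_rel x a)
  rw [swap_apply_of_ne_of_ne hx hy]

theorem orbitSetoid_swap_mul_sup (x y : α) (f : Perm α) :
    orbitSetoid (swap x y * f) ⊔ pairSetoid x y = orbitSetoid f ⊔ pairSetoid x y := by
  have key : ∀ g : Perm α, orbitSetoid (swap x y * g) ≤ orbitSetoid g ⊔ pairSetoid x y :=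
    fun g => (orbitSetoid_mul_le _ _).trans
      (sup_le ((orbitSetoid_swap_le x y).trans le_sup_right) le_sup_left)
  refine le_antisymm (sup_le (key f) le_sup_right) (sup_le ?_ le_sup_right)
  simpa using key (swap x y * f)

theorem sameCycle_swap_mul {x y : α} {f : Perm α} (h : ¬ f.SameCycle x y) :
    (swap x y * f).SameCycle x y := by
  by_contra hg
  have key : ∀ k : ℕ, (swap x y * f).SameCycle y ((f ^ k) y) := by
    intro k
    induction k with
    | zero => exact SameCycle.refl _ _
    | succ k ih =>
      have h₁ := sameCycle_apply_right.2 ih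
      rw [Perm.mul_apply] at h₁
      rw [pow_succ', Perm.mul_apply]
      have hx : f ((f ^ k) y) ≠ x := by
        rintro hx
        refine h (SameCycle.symm ⟨(k + 1 : ℕ), ?_⟩)
        rw [zpow_natCast, pow_succ', Perm.mul_apply, hx]
      have hy : f ((f ^ k) y) ≠ y := by
        intro hy
        rw [hy, swap_apply_right] at h₁
        exact hg h₁.symm
      rwa [swap_apply_of_ne_of_ne hx hy] at h₁
  obtain ⟨k, hk⟩ := SameCycle.exists_nat_pow_eq
    (sameCycle_inv_apply_self f y)
  have h₁ := sameCycle_apply_right.2 (key k)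
  rw [hk, Perm.mul_apply, apply_inv_apply, swap_apply_right] at h₁
  exact hg h₁.symm

theorem orbitSetoid_swap_mul {x y : α} {f : Perm α} (h : ¬ f.SameCycle x y) :
    orbitSetoid (swap x y * f) = orbitSetoid f ⊔ pairSetoid x y := by
  rw [← orbitSetoid_swap_mul_sup, eq_comm, sup_eq_left, pairSetoid_le_iff]
  exact sameCycle_swap_mul h

theorem numOrbits_swap_mul_lt {x y : α} {f : Perm α} (h : ¬ f.SameCycle x y) :
    numOrbits (swap x y * f) < numOrbits f := by
  rw [numOrbits, orbitSetoid_swap_mul h]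
  exact card_quotient_sup_pairSetoid_lt h

theorem numOrbits_swap_mul_le (x y : α) (f : Perm α) :
    numOrbits (swap x y * f) ≤ numOrbits f + 1 := by
  have h₁ := card_quotient_le_sup_pairSetoid (orbitSetoid (swap x y * f)) x y
  rw [orbitSetoid_swap_mul_sup] at h₁
  exact h₁.trans (Nat.add_le_add_right (card_quotient_le_of_le le_sup_left) 1)

end Swap

theorem numOrbits_mul_inv_comm {α : Type*} (π ρ : Perm α) :
    numOrbits (π * ρ⁻¹) = numOrbits (π⁻¹ * ρ) := by
  rw [← numOrbits_inv (π * ρ⁻¹), ← numOrbits_conj π (π⁻¹ * ρ)]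
  congr 1
  group

theorem orbitSetoid_one {α : Type*} : orbitSetoid (1 : Perm α) = ⊥ :=
  Setoid.ext fun _ _ => sameCycle_one

theorem numOrbits_add_le {α : Type*} [Finite α] (ρ π : Perm α) :
    numOrbits ρ + numOrbits π + numOrbits (π * ρ⁻¹) ≤ Nat.card α + 2 * numJoin π ρ := by
  classical
  have := Fintype.ofFinite α
  induction hn : π.support.card using Nat.strong_induction_on generalizing π with
  | _ n ih =>
  by_cases hπ : π = 1
  · subst hπ
    have h₁ : numOrbits (1 : Perm α) = Nat.card α := by
      rw [numOrbits, orbitSetoid_one]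
      exact Nat.card_congr Setoid.quotientBotEquiv
    have h₂ : numJoin 1 ρ = numOrbits ρ := by
      rw [numJoin, orbitSetoid_one, bot_sup_eq, numOrbits]
    rw [h₁, h₂, one_mul, numOrbits_inv]
    omega
  obtain ⟨x, hx⟩ : ∃ x, π x ≠ x := by
    by_contra! h
    exact hπ (Perm.ext h)
  obtain ⟨y, hy⟩ : ∃ y, y = π x := ⟨_, rfl⟩
  obtain ⟨φ, hφ⟩ : ∃ φ, φ = swap x y * π := ⟨_, rfl⟩
  have hπφ : π = swap x y * φ := by simp [hφ]
  have hφx : φ x = x := by simp [hφ, hy]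
  have hlt : φ.support.card < n := by
    rw [hφ, ← hn, hy]
    exact card_support_swap_mul hx
  have hxy : ¬ φ.SameCycle x y := by
    intro h
    exact hx (hy.symm.trans (h.eq_of_left hφx).symm)
  have hφle := ih _ hlt φ rfl
  have h₁ : numOrbits π < numOrbits φ := hπφ ▸ numOrbits_swap_mul_lt hxy
  have hJ : orbitSetoid π ⊔ orbitSetoid ρ =
      (orbitSetoid φ ⊔ orbitSetoid ρ) ⊔ pairSetoid x y := by
    rw [hπφ, orbitSetoid_swap_mul hxy, sup_right_comm]
  have hπρ : π * ρ⁻¹ = swap x y * (φ * ρ⁻¹) := by rw [hπφ, mul_assoc]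
  by_cases hj : (orbitSetoid φ ⊔ orbitSetoid ρ) x y
  · have h₂ : numJoin π ρ = numJoin φ ρ := by
      rw [numJoin, hJ, sup_eq_left.2 (pairSetoid_le_iff.2 hj), numJoin]
    have h₃ := numOrbits_swap_mul_le x y (φ * ρ⁻¹)
    rw [← hπρ] at h₃
    omega
  · have h₂ : numJoin φ ρ ≤ numJoin π ρ + 1 := by
      rw [numJoin, numJoin, hJ]
      exact card_quotient_le_sup_pairSetoid _ x y
    have hc : ¬ (φ * ρ⁻¹).SameCycle x y := fun h => hj (by
      have := orbitSetoid_mul_le φ ρ⁻¹ h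
      rwa [orbitSetoid_inv] at this)
    have h₃ := numOrbits_swap_mul_lt hc
    rw [← hπρ] at h₃
    omega

theorem euler_le {α : Type*} [Finite α] (ρ π : Perm α) : euler ρ π ≤ 2 * (numJoin π ρ : ℤ) := by
  have h := numOrbits_add_le ρ π
  rw [numOrbits_mul_inv_comm] at h
  rw [euler]
  omega

theorem numJoin_of_le {α : Type*} {π ρ : Perm α}
    (h : ∀ x y, π.SameCycle x y → ρ.SameCycle x y) : numJoin π ρ = numOrbits ρ := by
  rw [numJoin, numOrbits, sup_eq_right.2 fun x y hxy => h x y hxy]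

theorem tauPQ_apply_lt_iff (p q : ℕ) (x : Fin (p + q)) :
    ((tauPQ p q x : ℕ) < p) ↔ (x : ℕ) < p := by
  refine Fin.addCases (fun i => ?_) (fun i => ?_) x <;> simp [tauPQ, Equiv.permCongr_apply]

theorem sameCycle_finRotate (n : ℕ) (x y : Fin n) : (finRotate n).SameCycle x y := by
  match n with
  | 0 => exact x.elim0
  | 1 => exact Subsingleton.elim x y ▸ SameCycle.refl _ _
  | n + 2 =>
    refine isCycle_finRotate.sameCycle ?_ ?_ <;>
    · rw [← mem_support, support_finRotate]
      exact Finset.mem_univ _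

theorem tauPQ_sameCycle (p q : ℕ) (x y : Fin (p + q)) (h : (x : ℕ) < p ↔ (y : ℕ) < p) :
    (tauPQ p q).SameCycle x y := by
  have hl : ∀ i j : Fin p, (tauPQ p q).SameCycle (Fin.castAdd q i) (Fin.castAdd q j) := by
    intro i j
    have : orbitSetoid (finRotate p) ≤ (orbitSetoid (tauPQ p q)).comap (Fin.castAdd q) :=
      orbitSetoid_le_iff.2 fun i => by
        have := orbitSetoid_apply (tauPQ p q) (Fin.castAdd q i)
        simpa [tauPQ, Equiv.permCongr_apply, Setoid.comap_rel] using this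
    exact this (sameCycle_finRotate p i j)
  have hr : ∀ i j : Fin q, (tauPQ p q).SameCycle (Fin.natAdd p i) (Fin.natAdd p j) := by
    intro i j
    have : orbitSetoid (finRotate q) ≤ (orbitSetoid (tauPQ p q)).comap (Fin.natAdd p) :=
      orbitSetoid_le_iff.2 fun i => by
        have := orbitSetoid_apply (tauPQ p q) (Fin.natAdd p i)
        simpa [tauPQ, Equiv.permCongr_apply, Setoid.comap_rel] using this
    exact this (sameCycle_finRotate q i j)
  induction x using Fin.addCases with
  | left i =>
    induction y using Fin.addCases with
    | left j => exact hl i j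
    | right j => simp at h
  | right i =>
    induction y using Fin.addCases with
    | left j => simp at h
    | right j => exact hr i j

theorem numOrbits_tauPQ_le (p q : ℕ) : numOrbits (tauPQ p q) ≤ 2 := by
  have h : ∀ x y, (orbitSetoid (tauPQ p q)) x y → decide ((x : ℕ) < p) = decide ((y : ℕ) < p) := by
    have : orbitSetoid (tauPQ p q) ≤ Setoid.ker fun x : Fin (p + q) => decide ((x : ℕ) < p) :=
      orbitSetoid_le_iff.2 fun x => by simp [Setoid.ker_def, tauPQ_apply_lt_iff]
    exact fun x y hxy => this hxy
  have hc := Nat.card_le_card_of_injective (Quotient.lift _ h) (by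
    intro c d
    induction c using Quotient.inductionOn
    induction d using Quotient.inductionOn
    intro hcd
    exact Quotient.sound (tauPQ_sameCycle p q _ _ (by simpa using hcd)))
  rwa [Nat.card_eq_fintype_card (α := Bool), Fintype.card_bool] at hc

/-- If `π ⪯ ρ̂`, the join of the orbit partitions of `π` and `ρ` has at most one block fewer
than that of `ρ`. -/
theorem numOrbits_le_numJoin_add_one {p q : ℕ} (hp : 1 ≤ p) {π ρ : Perm (Fin (p + q))}
    (hπ : π ∈ SAnnNC p q) (hρ : ρ ∈ SDiscNC p q) (hle : leAnnHat p q π ρ) :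
    numOrbits ρ ≤ numJoin π ρ + 1 := by
  have hπτ := hπ.1
  have hρτ := hρ.1
  have hab := hle.2
  have hτ := numOrbits_tauPQ_le p q
  have hχ := euler_le ρ π
  rw [IsNoncrossingOn, euler] at hπτ hρτ hab
  rw [euler] at hχ
  rw [numJoin_of_le fun x y h => tauPQ_sameCycle p q x y (hρ.2 x y h)] at hρτ
  rw [numJoin_of_le hle.1] at hab
  have hconj : numOrbits ((ρ⁻¹ * tauPQ p q)⁻¹ * (π⁻¹ * tauPQ p q)) = numOrbits (π⁻¹ * ρ) := by
    rw [← numOrbits_conj (π⁻¹ * tauPQ p q)]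
    congr 1
    group
  rw [hconj] at hab
  have : Nonempty (Quotient (orbitSetoid π ⊔ orbitSetoid (tauPQ p q))) :=
    ⟨Quotient.mk _ ⟨0, by omega⟩⟩
  have hJ : 0 < numJoin π (tauPQ p q) := Nat.card_pos
  omega

theorem mem_bridgeSet_iff_of_sameCycle {p q : ℕ} {σ : Perm (Fin (p + q))} {x y : Fin (p + q)}
    (h : σ.SameCycle x y) : x ∈ BridgeSet p q σ ↔ y ∈ BridgeSet p q σ :=
  ⟨fun ⟨a, b, ha, hb, hab⟩ => ⟨a, b, h.symm.trans ha, h.symm.trans hb, hab⟩,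
    fun ⟨a, b, ha, hb, hab⟩ => ⟨a, b, h.trans ha, h.trans hb, hab⟩⟩

theorem mem_bridgeSet_of_sameCycle {p q : ℕ} {σ : Perm (Fin (p + q))} {x y : Fin (p + q)}
    (h : σ.SameCycle x y) (hs : ¬ ((x : ℕ) < p ↔ (y : ℕ) < p)) : x ∈ BridgeSet p q σ := by
  by_cases hx : (x : ℕ) < p
  · exact ⟨x, y, SameCycle.refl _ _, h, hx, by omega⟩
  · exact ⟨y, x, h, SameCycle.refl _ _, by omega, by omega⟩

end AnnNC

open AnnNC in
/-- every cycle of `Kr_ρ⁻¹(π) = ρπ⁻¹` is either contained in `K` or disjoint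
from it; moreover, on the complement of `K` the permutations `ρπ⁻¹` and
`Kr_ρ⁻¹(π₀) = ρπ₀⁻¹` agree (so cycles of `ρπ⁻¹` disjoint from `K` are cycles
of `ρπ₀⁻¹`). -/
theorem stmt6 (p q : ℕ) (hp : 1 ≤ p) (hq : 1 ≤ q)
    (π ρ : Equiv.Perm (Fin (p + q))) (hπ : π ∈ SAnnNC p q) (hρ : ρ ∈ SDiscNC p q)
    (π₀ : Equiv.Perm (Fin (p + q))) (hπ₀ : IsPiZero p q π π₀)
    (hle : leAnnHat p q π ρ)
    (u v : Fin (p + q)) (hu : (u : ℕ) < p) (hv : p ≤ (v : ℕ))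
    (hbr : ∀ x ∈ BridgeSet p q π, ρ.SameCycle u x ∨ ρ.SameCycle v x)
    (huB : ∃ a ∈ BridgeSet p q π, ρ.SameCycle u a)
    (hvB : ∃ b ∈ BridgeSet p q π, ρ.SameCycle v b)
    (K : Set (Fin (p + q)))
    (hK : K = BridgeSet p q (tauPQ p q * π⁻¹) ∩ {x | ρ.SameCycle u x ∨ ρ.SameCycle v x}) :
    (∀ x y : Fin (p + q), (ρ * π⁻¹).SameCycle x y → (x ∈ K ↔ y ∈ K)) ∧
    (∀ x ∉ K, (ρ * π⁻¹) x = (ρ * π₀⁻¹) x) := by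
  obtain ⟨a, ⟨a', b', haa', hab', ha', hb'⟩, hua⟩ := huB
  have hmem : ∀ z, π.SameCycle a z → ρ.SameCycle u z ∨ ρ.SameCycle v z := fun z hz =>
    hbr z ⟨a', b', hz.symm.trans haa', hz.symm.trans hab', ha', hb'⟩
  have hua' : ρ.SameCycle u a' := (hmem a' haa').resolve_right fun h => by
    have := hρ.2 _ _ h
    omega
  have hvb' : ρ.SameCycle v b' := (hmem b' hab').resolve_left fun h => by
    have := hρ.2 _ _ h
    omega
  have huv : ¬ ρ.SameCycle u v := fun h => by
    have := hρ.2 _ _ h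
    omega
  have hjoin : orbitSetoid ρ ⊔ pairSetoid u v = orbitSetoid π ⊔ orbitSetoid ρ := by
    refine eq_of_le_of_card_quotient_le (sup_le le_sup_right (pairSetoid_le_iff.2 ?_)) ?_
    · have hl : orbitSetoid π ≤ orbitSetoid π ⊔ orbitSetoid ρ := le_sup_left
      have hr : orbitSetoid ρ ≤ orbitSetoid π ⊔ orbitSetoid ρ := le_sup_right
      exact Setoid.trans' _ (hr hua')
        (Setoid.trans' _ (hl (haa'.symm.trans hab')) (hr hvb'.symm))
    · have h₁ := numOrbits_le_numJoin_add_one hp hπ hρ hle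
      have h₂ : _ < numOrbits ρ := card_quotient_sup_pairSetoid_lt (s := orbitSetoid ρ) huv
      rw [numJoin] at h₁
      omega
  have hUV : orbitSetoid π ⊔ orbitSetoid ρ ≤
      Setoid.ker fun x => ρ.SameCycle u x ∨ ρ.SameCycle v x := by
    rw [← hjoin]
    refine sup_le (fun x y (hxy : ρ.SameCycle x y) => ?_) (pairSetoid_le_iff.2 ?_)
    · exact propext ⟨Or.imp (·.trans hxy) (·.trans hxy),
        Or.imp (·.trans hxy.symm) (·.trans hxy.symm)⟩
    · exact propext ⟨fun _ => Or.inr (.refl _ _), fun _ => Or.inl (.refl _ _)⟩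
  have hcyc : orbitSetoid (ρ * π⁻¹) ≤ orbitSetoid (tauPQ p q * π⁻¹) := by
    refine orbitSetoid_le_iff.2 fun x => ?_
    have ha : (ρ⁻¹ * tauPQ p q) ((tauPQ p q)⁻¹ (ρ (π⁻¹ x))) = π⁻¹ x := by
      rw [Equiv.Perm.mul_apply, apply_inv_apply, Equiv.Perm.inv_eq_iff_eq]
    have h := hle.1 _ _ (orbitSetoid_apply (ρ⁻¹ * tauPQ p q) ((tauPQ p q)⁻¹ (ρ (π⁻¹ x))))
    rw [ha] at h
    have h' := h.conj (g := tauPQ p q)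
    rw [apply_inv_apply, mul_assoc, mul_assoc, mul_inv_cancel, mul_one] at h'
    exact Setoid.trans' _ (orbitSetoid_apply (tauPQ p q * π⁻¹) x) h'.symm
  subst hK
  constructor
  · intro x y hxy
    refine and_congr (mem_bridgeSet_iff_of_sameCycle (hcyc hxy)) ?_
    have h := orbitSetoid_mul_le ρ π⁻¹ hxy
    rw [orbitSetoid_inv, sup_comm] at h
    exact iff_of_eq (hUV h)
  · intro x hx
    rw [Equiv.Perm.mul_apply, Equiv.Perm.mul_apply]
    congr 1
    have hπx : π.SameCycle x (π⁻¹ x) :=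
      sameCycle_inv_apply_self π x
    have hside : ((π⁻¹ x : Fin (p + q)) : ℕ) < p ↔ (x : ℕ) < p := by
      by_contra hs
      refine hx ⟨mem_bridgeSet_of_sameCycle (orbitSetoid_apply (tauPQ p q * π⁻¹) x) ?_,
        hbr x (mem_bridgeSet_of_sameCycle hπx ?_)⟩
      · rw [Equiv.Perm.mul_apply, tauPQ_apply_lt_iff]
        exact fun h => hs h.symm
      · exact fun h => hs h.symm
    obtain ⟨k, hk, hk₀, -, hmin⟩ := hπ₀ (π⁻¹ x)
    have hk1 : k = 1 := by
      by_contra hne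
      exact hmin 1 one_pos (by omega) (by simpa using hside)
    rw [eq_comm, Equiv.Perm.inv_eq_iff_eq, hk₀, hk1, pow_one, apply_inv_apply]
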